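/- arXiv:2008.03770 — 2 statements merged into one kernel-verified Lean document; each statement's English description precedes it below -/
import Mathlib

section
/- Let G = (A, S) be a parameterized safety game on a complete parameterized arena A with initial vertex v₀, in which every unsafe vertex is a sink. If σ is a winning coalition strategy from v₀, then the coalition strategy h ↦ σ(zip(h)) is also winning from v₀. Consequently, there exists a winning coalition strategy from v₀ if and only if there exists a winning coalition strategy σ that factors through loop-erasure, i.e. σ(h) = σ(zip(h)) for every history h from v₀. -/
/-- The prefix of length `k` of an infinite word `w`. -/
def wordPrefix {A : Type*} (w : ℕ → A) (k : ℕ) : List A := (List.range k).map w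

/-- The history `ρ 0, ρ 1, …, ρ j` of a play `ρ`. -/
def histUpTo {V : Type*} (ρ : ℕ → V) (j : ℕ) : List V := (List.range (j+1)).map ρ

/-- `h` is a history from `v₀`: nonempty, starts at `v₀`, and consecutive vertices
are linked by a nonempty transition language. -/
def IsHist {V A : Type*} (Δ : V → V → Set (List A)) (v₀ : V) (h : List V) : Prop :=
  h ≠ [] ∧ h.head? = some v₀ ∧ List.Chain' (fun u w => (Δ u w).Nonempty) h

/-- Membership of the play `ρ` in the `k`-outcome of the coalition strategy `σ` from `v₀`. -/
def InOutcome {V A : Type*} (Δ : V → V → Set (List A)) (v₀ : V) (σ : List V → ℕ → A)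
    (k : ℕ) (ρ : ℕ → V) : Prop :=
  ρ 0 = v₀ ∧ ∀ j : ℕ, wordPrefix (σ (histUpTo ρ j)) k ∈ Δ (ρ j) (ρ (j+1))

/-- The coalition strategy `σ` is winning from `v₀` for the safe set `S`. -/
def WinningFrom {V A : Type*} (Δ : V → V → Set (List A)) (S : Set V) (v₀ : V)
    (σ : List V → ℕ → A) : Prop :=
  ∀ k : ℕ, 1 ≤ k → ∀ ρ : ℕ → V, InOutcome Δ v₀ σ k ρ → ∀ j : ℕ, ρ j ∈ S

/-- Auxiliary loop-erasure on reversed histories (most recent vertex first). -/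
def zipAux {V : Type*} [DecidableEq V] : List V → List V
  | [] => []
  | v' :: rest =>
    let z := zipAux rest
    if v' ∈ z then z.dropWhile (fun x => decide (x ≠ v')) else v' :: z

/-- The loop-erasure map `zip` on histories. -/
def zip {V : Type*} [DecidableEq V] (h : List V) : List V := (zipAux h.reverse).reverse

/-- All words of the transition languages are nonempty. -/
def NonemptyWords {V A : Type*} (Δ : V → V → Set (List A)) : Prop :=
  ∀ v w : V, ∀ u ∈ Δ v w, u ≠ ([] : List A)

/-- Completeness of the arena. -/
def CompleteArena {V A : Type*} (Δ : V → V → Set (List A)) : Prop :=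
  ∀ v : V, ∀ u : List A, u ≠ [] → ∃ w : V, u ∈ Δ v w

/-- Every unsafe vertex is a sink. -/
def UnsafeSinks {V A : Type*} (Δ : V → V → Set (List A)) (S : Set V) : Prop :=
  ∀ v ∉ S, Δ v v = {u : List A | u ≠ []} ∧ ∀ w : V, w ≠ v → Δ v w = (∅ : Set (List A))

/-- A language of finite words is regular if it is accepted by a DFA with finitely
many states. -/
def IsRegularLang {A : Type*} (L : Set (List A)) : Prop :=
  ∃ (Q : Type) (_ : Fintype Q) (M : DFA A Q), ∀ u : List A, u ∈ M.accepts ↔ u ∈ L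

/-- The strategy `σ` uses the memory set `M`. -/
def UsesMemory {V A : Type*} (Δ : V → V → Set (List A)) (v₀ : V)
    (σ : List V → ℕ → A) (M : Type) : Prop :=
  ∃ (minit : M) (upd : M → V → M) (next : M → V → ℕ → A),
    ∀ h : List V, IsHist Δ v₀ h → σ h = next (h.tail.foldl upd minit) (h.getLastD v₀)

/-- A reversed finite history from `v₀`, most recent vertex first, each step of which is allowed
by the length-`k` prefixes of the words prescribed by `σ`. -/
def RevConsistent {V A : Type*} (Δ : V → V → Set (List A)) (v₀ : V) (σ : List V → ℕ → A)
    (k : ℕ) : List V → Prop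
  | [] => False
  | [v] => v = v₀
  | v :: w :: r =>
    wordPrefix (σ (w :: r).reverse) k ∈ Δ w v ∧ RevConsistent Δ v₀ σ k (w :: r)

theorem histUpTo_succ_reverse {V : Type*} (ρ : ℕ → V) (j : ℕ) :
    (histUpTo ρ (j + 1)).reverse = ρ (j + 1) :: (histUpTo ρ j).reverse := by
  simp [histUpTo, List.range_succ]

namespace RevConsistent

variable {V A : Type*} {Δ : V → V → Set (List A)} {v₀ : V} {σ : List V → ℕ → A} {k : ℕ}

theorem dropWhile_ne [DecidableEq V] {l : List V} (h : RevConsistent Δ v₀ σ k l) {v : V}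
    (hv : v ∈ l) :
    RevConsistent Δ v₀ σ k (l.dropWhile (fun x => decide (x ≠ v))) ∧
      (l.dropWhile (fun x => decide (x ≠ v))).head? = some v := by
  induction l with
  | nil => exact h.elim
  | cons a t ih =>
    by_cases hav : a = v
    · subst hav
      simpa using h
    · have hvt : v ∈ t := (List.mem_cons.mp hv).resolve_left (Ne.symm hav)
      have ht : RevConsistent Δ v₀ σ k t := by
        cases t with
        | nil => simp at hvt
        | cons b r => exact h.2
      simpa [hav] using ih ht hvt

theorem singleton_suffix {l : List V} (h : RevConsistent Δ v₀ σ k l) : [v₀] <:+ l := by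
  induction l with
  | nil => exact h.elim
  | cons a t ih =>
    cases t with
    | nil =>
      obtain rfl : a = v₀ := h
      exact List.suffix_refl _
    | cons b r => exact (ih h.2).trans (List.suffix_cons _ _)

theorem of_suffix {l l' : List V} (h : RevConsistent Δ v₀ σ k l) (hs : l' <:+ l)
    (hl' : l' ≠ []) : RevConsistent Δ v₀ σ k l' := by
  induction l with
  | nil => exact h.elim
  | cons a t ih =>
    rcases List.suffix_cons_iff.mp hs with rfl | hs
    · exact h
    · cases t with
      | nil => exact absurd (List.suffix_nil.mp hs) hl'
      | cons b r => exact ih h.2 hs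

theorem exists_cons {l : List V} (hcomp : CompleteArena Δ) (hk : 1 ≤ k)
    (h : RevConsistent Δ v₀ σ k l) : ∃ w, RevConsistent Δ v₀ σ k (w :: l) := by
  cases l with
  | nil => exact h.elim
  | cons a t =>
    have hu : wordPrefix (σ (a :: t).reverse) k ≠ [] := by
      simp [wordPrefix]
      omega
    obtain ⟨w, hw⟩ := hcomp a _ hu
    exact ⟨w, hw, h⟩

/-- In a complete arena, every finite history consistent with `σ` extends to a play in the
`k`-outcome of `σ`. -/
theorem exists_inOutcome {l : List V} (hcomp : CompleteArena Δ) (hk : 1 ≤ k)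
    (h : RevConsistent Δ v₀ σ k l) :
    ∃ ρ : ℕ → V, InOutcome Δ v₀ σ k ρ ∧ ∃ n, (histUpTo ρ n).reverse = l := by
  have hstep : ∀ l' : List V, ∃ w, RevConsistent Δ v₀ σ k l' →
      RevConsistent Δ v₀ σ k (w :: l') ∧ (l' <:+ l → l' ≠ l → w :: l' <:+ l) := by
    intro l'
    by_cases hl' : RevConsistent Δ v₀ σ k l'
    · by_cases hs : l' <:+ l ∧ l' ≠ l
      · obtain ⟨⟨p, hp⟩, hne⟩ := hs
        rcases List.eq_nil_or_concat p with rfl | ⟨q, w, rfl⟩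
        · exact absurd hp hne
        · have hw : w :: l' <:+ l := ⟨q, by simpa using hp⟩
          exact ⟨w, fun _ => ⟨h.of_suffix hw (by simp), fun _ _ => hw⟩⟩
      · obtain ⟨w, hw⟩ := hl'.exists_cons hcomp hk
        exact ⟨w, fun _ => ⟨hw, fun h₁ h₂ => absurd ⟨h₁, h₂⟩ hs⟩⟩
    · exact ⟨v₀, fun h' => absurd h' hl'⟩
  choose f hf using hstep
  obtain ⟨L, hL0, hLs⟩ : ∃ L : ℕ → List V, L 0 = [v₀] ∧ ∀ n, L (n + 1) = f (L n) :: L n :=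
    ⟨fun n => Nat.rec [v₀] (fun _ l' => f l' :: l') n, rfl, fun _ => rfl⟩
  have hLc : ∀ n, RevConsistent Δ v₀ σ k (L n) := by
    intro n
    induction n with
    | zero => rw [hL0]; rfl
    | succ n ih => rw [hLs]; exact (hf _ ih).1
  have hLlen : ∀ n, (L n).length = n + 1 := by
    intro n
    induction n with
    | zero => rw [hL0]; rfl
    | succ n ih => rw [hLs, List.length_cons, ih]
  have hLsuf : ∀ n, n < l.length → L n <:+ l := by
    intro n
    induction n with
    | zero => exact fun _ => hL0 ▸ h.singleton_suffix
    | succ n ih =>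
      intro hn
      rw [hLs]
      refine (hf _ (hLc n)).2 (ih (by omega)) fun he => ?_
      have := hLlen n
      rw [he] at this
      omega
  let ρ : ℕ → V := fun n => (L n).headD v₀
  have hρ : ∀ n, (histUpTo ρ n).reverse = L n := by
    intro n
    induction n with
    | zero => simp [histUpTo, ρ, hL0]
    | succ n ih => rw [histUpTo_succ_reverse, ih]; simp [ρ, hLs]
  refine ⟨ρ, ⟨by simp [ρ, hL0], fun j => ?_⟩, l.length - 1, ?_⟩
  · have hj : RevConsistent Δ v₀ σ k (histUpTo ρ (j + 1)).reverse := by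
      rw [hρ]
      exact hLc _
    rw [histUpTo_succ_reverse] at hj
    cases j with
    | zero => exact hj.1
    | succ j =>
      rw [histUpTo_succ_reverse] at hj
      have := hj.1
      rwa [← histUpTo_succ_reverse, List.reverse_reverse] at this
  · have hpos : 0 < l.length := List.length_pos_of_ne_nil (by rintro rfl; exact h)
    rw [hρ]
    refine (hLsuf _ (by omega)).eq_of_length ?_
    rw [hLlen]
    omega

/-- Loop-erasing a finite prefix of a play consistent with `σ ∘ zip` gives a history consistent
with `σ` and ending in the same vertex. -/
theorem zipAux_histUpTo [DecidableEq V] {ρ : ℕ → V}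
    (hρ : InOutcome Δ v₀ (fun h => σ (zip h)) k ρ) (j : ℕ) :
    RevConsistent Δ v₀ σ k (zipAux (histUpTo ρ j).reverse) ∧
      (zipAux (histUpTo ρ j).reverse).head? = some (ρ j) := by
  induction j with
  | zero => simpa [histUpTo, zipAux, RevConsistent] using hρ.1
  | succ j ih =>
    obtain ⟨hc, hhead⟩ := ih
    rw [histUpTo_succ_reverse, zipAux]
    split_ifs with hmem
    · exact hc.dropWhile_ne hmem
    · refine ⟨?_, rfl⟩
      have hj := hρ.2 j
      simp only [zip] at hj
      generalize zipAux (histUpTo ρ j).reverse = z at *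
      cases z with
      | nil => exact hc.elim
      | cons a t =>
        obtain rfl : a = ρ j := by simpa using hhead
        exact ⟨hj, hc⟩

end RevConsistent

theorem nodup_zipAux {V : Type*} [DecidableEq V] (l : List V) : (zipAux l).Nodup := by
  induction l with
  | nil => exact List.nodup_nil
  | cons a t ih =>
    rw [zipAux]
    split_ifs with hmem
    · exact ih.sublist (List.dropWhile_sublist _)
    · exact List.nodup_cons.mpr ⟨hmem, ih⟩

theorem zipAux_eq_self_of_nodup {V : Type*} [DecidableEq V] {l : List V} (h : l.Nodup) :
    zipAux l = l := by
  induction l with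
  | nil => rfl
  | cons a t ih =>
    obtain ⟨ha, ht⟩ := List.nodup_cons.mp h
    simp [zipAux, ih ht, ha]

theorem zip_zip {V : Type*} [DecidableEq V] (h : List V) : zip (zip h) = zip h := by
  simp only [zip, List.reverse_reverse]
  rw [zipAux_eq_self_of_nodup (nodup_zipAux _)]

theorem WinningFrom.comp_zip {V A : Type*} [DecidableEq V] {Δ : V → V → Set (List A)}
    {S : Set V} {v₀ : V} {σ : List V → ℕ → A} (hcomp : CompleteArena Δ)
    (hσ : WinningFrom Δ S v₀ σ) : WinningFrom Δ S v₀ (fun h => σ (zip h)) := by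
  intro k hk ρ hρ j
  obtain ⟨hc, hhead⟩ := RevConsistent.zipAux_histUpTo hρ j
  obtain ⟨τ, hτ, n, hn⟩ := hc.exists_inOutcome hcomp hk
  have hlast : τ n = ρ j := by
    rw [← hn] at hhead
    simpa [histUpTo, List.range_succ] using hhead
  exact hlast ▸ hσ k hk τ hτ n

/-- if `σ` is a winning coalition strategy from `v₀` in a parameterized
safety game (complete arena, regular transition languages, unsafe vertices are sinks),
then `h ↦ σ (zip h)` is also winning from `v₀`; consequently a winning coalition
strategy from `v₀` exists iff one exists that factors through loop-erasure. -/
theorem stmt0 {V A : Type} [Fintype V] [DecidableEq V] [Fintype A]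
    (Δ : V → V → Set (List A)) (S : Set V) (v₀ : V)
    (hreg : ∀ v w : V, IsRegularLang (Δ v w))
    (hne : NonemptyWords Δ)
    (hcomp : CompleteArena Δ)
    (hsink : UnsafeSinks Δ S) :
    (∀ σ : List V → ℕ → A, WinningFrom Δ S v₀ σ →
      WinningFrom Δ S v₀ (fun h => σ (zip h))) ∧
    ((∃ σ : List V → ℕ → A, WinningFrom Δ S v₀ σ) ↔
      (∃ σ : List V → ℕ → A, WinningFrom Δ S v₀ σ ∧
        ∀ h : List V, IsHist Δ v₀ h → σ h = σ (zip h))) := by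
  exact ⟨fun σ hσ => hσ.comp_zip hcomp,
    fun ⟨σ, hσ⟩ => ⟨fun h => σ (zip h), hσ.comp_zip hcomp, fun h _ => by simp only [zip_zip]⟩,
    fun ⟨σ, hσ, _⟩ => ⟨σ, hσ⟩⟩
end

section
/- Let G = (A, S) be a parameterized safety game on a complete parameterized arena with N vertices, in which every unsafe vertex is a sink, and let v₀ be an initial vertex. If there exists a winning coalition strategy from v₀, then there exists a winning coalition strategy from v₀ that uses a finite memory set M with |M| ≤ N^N. -/
section LoopErasure

variable {V : Type*}

/-- The play `ρ` up to time `j + 1` is the play up to time `j` followed by `ρ (j + 1)`. -/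
theorem histUpTo_succ (ρ : ℕ → V) (j : ℕ) :
    histUpTo ρ (j + 1) = histUpTo ρ j ++ [ρ (j + 1)] := by
  simp [histUpTo, List.range_succ (n := j + 1)]

variable [DecidableEq V]

/-- Append `v` to `l`, erasing the loop this closes if `v` already occurs in `l`. -/
def eraseConcat (l : List V) (v : V) : List V :=
  l.takeWhile (fun x => decide (x ≠ v)) ++ [v]

theorem eraseConcat_prefix (l : List V) (v : V) : eraseConcat l v <+: l ++ [v] := by
  induction l with
  | nil => simp [eraseConcat]
  | cons a l ih =>
    by_cases h : a = v
    · simp [eraseConcat, h]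
    · simpa [eraseConcat, h] using ih

theorem nodup_eraseConcat {l : List V} (hl : l.Nodup) (v : V) : (eraseConcat l v).Nodup := by
  refine List.Nodup.append (hl.sublist (List.takeWhile_sublist _)) (List.nodup_singleton v) ?_
  intro x hx hx'
  have := List.mem_takeWhile_imp hx
  simp_all

theorem head?_eraseConcat {l : List V} {a : V} (hl : l.head? = some a) (v : V) :
    (eraseConcat l v).head? = some a := by
  obtain ⟨t, rfl⟩ := List.head?_eq_some_iff.mp hl
  by_cases h : a = v <;> simp [eraseConcat, h]

/-- The successor map of a simple path: it sends every vertex but the last one to the next vertex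
of the path, and fixes all other vertices. -/
def pathSucc : List V → V → V
  | [] => id
  | [_] => id
  | a :: b :: t => Function.update (pathSucc (b :: t)) a b

theorem pathSucc_of_notMem {l : List V} {a : V} (h : a ∉ l) : pathSucc l a = a := by
  fun_induction pathSucc l with
  | case1 => rfl
  | case2 => rfl
  | case3 x b t ih =>
    rw [List.mem_cons, not_or] at h
    rw [Function.update_of_ne h.1, ih h.2]

theorem pathSucc_injective {l l' : List V} (hl : l.Nodup) (hl' : l'.Nodup)
    (hhead : l.head? = l'.head?) (h : pathSucc l = pathSucc l') : l = l' := by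
  induction l generalizing l' with
  | nil => simpa [eq_comm] using hhead
  | cons a t ih =>
    obtain _ | ⟨a', t'⟩ := l'
    · simp at hhead
    obtain rfl : a = a' := by simpa using hhead
    rw [List.nodup_cons] at hl hl'
    have ha := congrFun h a
    obtain _ | ⟨b, t⟩ := t <;> obtain _ | ⟨b', t'⟩ := t'
    · rfl
    · simp only [pathSucc, id, Function.update_self] at ha
      simp [ha] at hl'
    · simp only [pathSucc, id, Function.update_self] at ha
      simp [ha] at hl
    · obtain rfl : b = b' := by simpa [pathSucc] using ha
      congr 1
      refine ih hl.2 hl'.2 rfl (funext fun x => ?_)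
      by_cases hx : x = a
      · rw [hx, pathSucc_of_notMem hl.1, pathSucc_of_notMem hl'.1]
      · simpa [pathSucc, hx] using congrFun h x

/-- The simple paths starting at `v₀`. -/
def SimplePath (v₀ : V) : Type _ := {l : List V // l.Nodup ∧ l.head? = some v₀}

/-- Extend a simple path by a vertex, erasing the loop this may close. -/
def SimplePath.step {v₀ : V} (m : SimplePath v₀) (v : V) : SimplePath v₀ :=
  ⟨eraseConcat m.1 v, nodup_eraseConcat m.2.1 v, head?_eraseConcat m.2.2 v⟩

/-- The simple path reduced to its initial vertex. -/
def SimplePath.single (v₀ : V) : SimplePath v₀ :=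
  ⟨[v₀], List.nodup_singleton v₀, rfl⟩

theorem SimplePath.pathSucc_injective (v₀ : V) :
    Function.Injective (fun m : SimplePath v₀ => pathSucc m.1) :=
  fun m m' h => Subtype.ext (_root_.pathSucc_injective m.2.1 m'.2.1 (m.2.2.trans m'.2.2.symm) h)

/-- The loop erasure of a history from `v₀`. -/
def loopErasure (v₀ : V) (h : List V) : SimplePath v₀ :=
  h.tail.foldl SimplePath.step (SimplePath.single v₀)

theorem loopErasure_histUpTo_succ (v₀ : V) (ρ : ℕ → V) (j : ℕ) :
    loopErasure v₀ (histUpTo ρ (j + 1)) = (loopErasure v₀ (histUpTo ρ j)).step (ρ (j + 1)) := by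
  have : histUpTo ρ j ≠ [] := by simp [histUpTo]
  simp [loopErasure, histUpTo_succ, List.tail_append_of_ne_nil this]

end LoopErasure

section Consistent

variable {V A : Type*} {Δ : V → V → Set (List A)} {σ : List V → ℕ → A} {k : ℕ}

/-- Every step of the finite path `l` is compatible with the coalition strategy `σ` played by
`k` agents. -/
def Consistent (Δ : V → V → Set (List A)) (σ : List V → ℕ → A) (k : ℕ) (l : List V) : Prop :=
  ∀ i a b, l[i]? = some a → l[i + 1]? = some b → wordPrefix (σ (l.take (i + 1))) k ∈ Δ a b

theorem consistent_singleton (v : V) : Consistent Δ σ k [v] := by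
  intro i a b _ h
  simp at h

theorem Consistent.of_prefix {p l : List V} (hl : Consistent Δ σ k l) (hp : p <+: l) :
    Consistent Δ σ k p := by
  obtain ⟨s, rfl⟩ := hp
  intro i a b ha hb
  obtain ⟨hi, rfl⟩ := List.getElem?_eq_some_iff.mp ha
  obtain ⟨hi', rfl⟩ := List.getElem?_eq_some_iff.mp hb
  have := hl i p[i] p[i + 1] (by simp [List.getElem?_append_left hi])
    (by simp [List.getElem?_append_left hi'])
  rwa [List.take_append_of_le_length (by omega)] at this

theorem Consistent.concat {l : List V} {a v : V} (hl : Consistent Δ σ k l)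
    (ha : l.getLast? = some a) (hv : wordPrefix (σ l) k ∈ Δ a v) :
    Consistent Δ σ k (l ++ [v]) := by
  intro i x y hx hy
  have hi : i + 1 < (l ++ [v]).length := (List.getElem?_eq_some_iff.mp hy).1
  rw [List.length_append, List.length_singleton] at hi
  rw [List.take_append_of_le_length (by omega)]
  rw [List.getElem?_append_left (by omega)] at hx
  rcases Nat.lt_or_ge (i + 1) l.length with h | h
  · rw [List.getElem?_append_left h] at hy
    exact hl i x y hx hy
  · obtain hlen : l.length = i + 1 := by omega
    rw [List.getLast?_eq_getElem?, hlen, Nat.add_sub_cancel, hx] at ha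
    rw [List.getElem?_append_right h, hlen] at hy
    simp only [Nat.sub_self, List.getElem?_cons_zero, Option.some.injEq] at ha hy
    rw [List.take_of_length_le h, ha, ← hy]
    exact hv

/-- In a complete arena every consistent finite path is an initial segment of a play in the
outcome of the strategy. -/
theorem Consistent.exists_inOutcome (hcomp : CompleteArena Δ) (hk : 1 ≤ k) {v₀ : V} {l : List V}
    (hl : Consistent Δ σ k l) (hhead : l.head? = some v₀) :
    ∃ ρ, InOutcome Δ v₀ σ k ρ ∧ ∀ i a, l[i]? = some a → ρ i = a := by
  have hext : ∀ m : List V, ∃ b, m ≠ [] → Consistent Δ σ k m → Consistent Δ σ k (m ++ [b]) := by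
    intro m
    by_cases hm : m = []
    · exact ⟨v₀, fun h => absurd hm h⟩
    obtain ⟨b, hb⟩ := hcomp (m.getLast hm) (wordPrefix (σ m) k)
      (by simp only [wordPrefix, ne_eq, List.map_eq_nil_iff, List.range_eq_nil]; omega)
    exact ⟨b, fun _ hc => hc.concat (List.getLast?_eq_some_getLast hm) hb⟩
  choose ext hext using hext
  let H : ℕ → List V := fun n => n.rec l fun _ m => m ++ [ext m]
  have hlne : l ≠ [] := by rintro rfl; simp at hhead
  have hlen (n : ℕ) : (H n).length = l.length + n := by
    induction n with
    | zero => rfl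
    | succ n ih => simp only [H, List.length_append, List.length_singleton] at ih ⊢; omega
  have hpos : 0 < l.length := List.length_pos_iff.mpr hlne
  have hne (n : ℕ) : H n ≠ [] := by
    rw [← List.length_pos_iff, hlen]; omega
  have hcons (n : ℕ) : Consistent Δ σ k (H n) := by
    induction n with
    | zero => exact hl
    | succ n ih => exact hext _ (hne n) ih
  have hpre {m n : ℕ} (h : m ≤ n) : H m <+: H n := by
    induction n, h using Nat.le_induction with
    | base => exact List.prefix_rfl
    | succ n _ ih => exact ih.trans (List.prefix_append _ _)
  have hget {p m : List V} (hp : p <+: m) {i : ℕ} {a : V} (h : p[i]? = some a) :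
      m[i]? = some a := by
    obtain ⟨s, rfl⟩ := hp
    rwa [List.getElem?_append_left (List.getElem?_eq_some_iff.mp h).1]
  let ρ : ℕ → V := fun i => (H i)[i]'(by rw [hlen]; omega)
  have hρ {i n : ℕ} (h : i ≤ n) : (H n)[i]? = some (ρ i) :=
    hget (hpre h) (List.getElem?_eq_getElem _)
  have hρl (i : ℕ) (a : V) (h : l[i]? = some a) : ρ i = a :=
    Option.some.inj ((hρ le_rfl).symm.trans (hget (hpre (Nat.zero_le i)) h))
  refine ⟨ρ, ⟨hρl 0 v₀ (by rw [← List.head?_eq_getElem?, hhead]), fun j => ?_⟩, hρl⟩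
  have hhist : histUpTo ρ j = (H (j + 1)).take (j + 1) := by
    refine List.ext_getElem? fun i => ?_
    rw [List.getElem?_take]
    split_ifs with hi
    · rw [hρ hi.le]
      simp [histUpTo, hi]
    · simp [histUpTo]; omega
  rw [hhist]
  exact hcons (j + 1) j _ _ (hρ (Nat.le_succ j)) (hρ (le_refl (j + 1)))

end Consistent

section Winning

variable {V A : Type*} [DecidableEq V] {Δ : V → V → Set (List A)} {S : Set V} {v₀ : V}
  {σ : List V → ℕ → A}

theorem InOutcome.consistent_loopErasure {k : ℕ} {ρ : ℕ → V}
    (hρ : InOutcome Δ v₀ (fun h => σ (loopErasure v₀ h).1) k ρ) (j : ℕ) :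
    Consistent Δ σ k (loopErasure v₀ (histUpTo ρ j)).1 ∧
      (loopErasure v₀ (histUpTo ρ j)).1.getLast? = some (ρ j) := by
  induction j with
  | zero => exact ⟨consistent_singleton v₀, by rw [hρ.1]; rfl⟩
  | succ j ih =>
    rw [loopErasure_histUpTo_succ]
    exact ⟨(ih.1.concat ih.2 (hρ.2 j)).of_prefix (eraseConcat_prefix _ _),
      by simp [SimplePath.step, eraseConcat]⟩

theorem WinningFrom.comp_loopErasure (hcomp : CompleteArena Δ) (hσ : WinningFrom Δ S v₀ σ) :
    WinningFrom Δ S v₀ (fun h => σ (loopErasure v₀ h).1) := by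
  intro k hk ρ hρ j
  obtain ⟨hc, hlast⟩ := hρ.consistent_loopErasure j
  obtain ⟨ρ', hρ', hext⟩ := hc.exists_inOutcome hcomp hk (loopErasure v₀ (histUpTo ρ j)).2.2
  rw [List.getLast?_eq_getElem?] at hlast
  rw [← hext _ _ hlast]
  exact hσ k hk ρ' hρ' _

end Winning

/-- in a parameterized safety game on a complete arena with `N` vertices
(unsafe vertices being sinks), if there is a winning coalition strategy from `v₀` then
there is one using a finite memory set `M` with `|M| ≤ N ^ N`. -/
theorem stmt4 {V A : Type} [Fintype V] [Fintype A]
    (Δ : V → V → Set (List A)) (S : Set V) (v₀ : V)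
    (hreg : ∀ v w : V, IsRegularLang (Δ v w))
    (hne : NonemptyWords Δ)
    (hcomp : CompleteArena Δ)
    (hsink : UnsafeSinks Δ S)
    (hwin : ∃ σ : List V → ℕ → A, WinningFrom Δ S v₀ σ) :
    ∃ σ : List V → ℕ → A, WinningFrom Δ S v₀ σ ∧
      ∃ (M : Type) (_ : Fintype M),
        Fintype.card M ≤ Fintype.card V ^ Fintype.card V ∧ UsesMemory Δ v₀ σ M := by
  classical
  obtain ⟨σ, hσ⟩ := hwin
  have hinj := SimplePath.pathSucc_injective v₀
  let _ : Fintype (SimplePath v₀) := Fintype.ofInjective _ hinj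
  refine ⟨_, hσ.comp_loopErasure hcomp, SimplePath v₀, inferInstance, ?_,
    SimplePath.single v₀, SimplePath.step, fun m _ => σ m.1, fun _ _ => rfl⟩
  simpa using Fintype.card_le_of_injective _ hinj
end
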